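/- arXiv:1301.6495 — 2 statements merged into one kernel-verified Lean document; each statement's English description precedes it below -/
import Mathlib

section
/- Let 𝔞 be a regular ideal of 𝒪_D. Then the index of Γ₀^D(𝔞) in SL₂(𝒪_D) equals N(𝔞) · ∏_{p ∣ N(𝔞)} (1 + 1/p)^{c_p(𝔞)}, where the product runs over all prime numbers p dividing N(𝔞), and c_p(𝔞) = 2 if p ∤ D and 𝔞 ⊆ p·𝒪_D, while c_p(𝔞) = 1 otherwise; the equality is of rational numbers. -/
/-- The quadratic order `𝒪_D` of square discriminant `D = d²`,
realized as the subring `{(x,y) ∈ ℤ × ℤ : x ≡ y (mod d)}` of `ℤ × ℤ`. -/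
def Od (d : ℤ) : Subring (ℤ × ℤ) where
  carrier := {z | d ∣ z.1 - z.2}
  one_mem' := by simp
  zero_mem' := by simp
  mul_mem' := by
    rintro a b ha hb
    show d ∣ a.1 * b.1 - a.2 * b.2
    have h : a.1 * b.1 - a.2 * b.2 = (a.1 - a.2) * b.1 + a.2 * (b.1 - b.2) := by ring
    rw [h]
    exact dvd_add (ha.mul_right b.1) (hb.mul_left a.2)
  add_mem' := by
    rintro a b ha hb
    show d ∣ a.1 + b.1 - (a.2 + b.2)
    have h : a.1 + b.1 - (a.2 + b.2) = (a.1 - a.2) + (b.1 - b.2) := by ring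
    rw [h]
    exact dvd_add ha hb
  neg_mem' := by
    rintro a ha
    show d ∣ -a.1 - -a.2
    have h : -a.1 - -a.2 = -(a.1 - a.2) := by ring
    rw [h]
    exact ha.neg_right

lemma mem_Od {d : ℤ} {z : ℤ × ℤ} : z ∈ Od d ↔ d ∣ z.1 - z.2 := Iff.rfl

/-- The element `w = (0, d)` of the standard basis of `𝒪_D`. -/
def wd (d : ℤ) : Od d := ⟨(0, d), mem_Od.mpr ⟨-1, by ring⟩⟩


open Matrix

variable (R : Type*) [CommRing R]

/-- The Hecke congruence subgroup `Γ₀(𝔞)` of `SL₂(R)`: matrices whose lower-left entry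
lies in the ideal `𝔞`. -/
def GammaZero (A : Ideal R) : Subgroup (Matrix.SpecialLinearGroup (Fin 2) R) where
  carrier := {M | M.1 1 0 ∈ A}
  one_mem' := by
    show (1 : Matrix.SpecialLinearGroup (Fin 2) R).1 1 0 ∈ A
    simp
  mul_mem' := by
    rintro M N hM hN
    show (M * N).1 1 0 ∈ A
    have e : (M * N).1 1 0 = M.1 1 0 * N.1 0 0 + M.1 1 1 * N.1 1 0 := by
      simp [Matrix.SpecialLinearGroup.coe_mul, Matrix.mul_apply, Fin.sum_univ_two]
    rw [e]
    exact A.add_mem (A.mul_mem_right _ hM) (A.mul_mem_left _ hN)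
  inv_mem' := by
    rintro M hM
    show (M⁻¹).1 1 0 ∈ A
    rw [Matrix.SpecialLinearGroup.SL2_inv_expl M]
    simpa using A.neg_mem hM

/-- The congruence subgroup `Γ₁(𝔞)` of `SL₂(R)`: matrices whose lower-left entry and
whose diagonal entries minus `1` lie in the ideal `𝔞`. -/
def GammaOne (A : Ideal R) : Subgroup (Matrix.SpecialLinearGroup (Fin 2) R) where
  carrier := {M | M.1 1 0 ∈ A ∧ M.1 0 0 - 1 ∈ A ∧ M.1 1 1 - 1 ∈ A}
  one_mem' := by
    refine ⟨?_, ?_, ?_⟩ <;>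
      · show _ ∈ A
        simp
  mul_mem' := by
    rintro M N ⟨hM0, hM1, hM2⟩ ⟨hN0, hN1, hN2⟩
    have e : ∀ i j, (M * N).1 i j = M.1 i 0 * N.1 0 j + M.1 i 1 * N.1 1 j := by
      intro i j
      simp [Matrix.SpecialLinearGroup.coe_mul, Matrix.mul_apply, Fin.sum_univ_two]
    refine ⟨?_, ?_, ?_⟩
    · show (M * N).1 1 0 ∈ A
      rw [e]
      exact A.add_mem (A.mul_mem_right _ hM0) (A.mul_mem_left _ hN0)
    · show (M * N).1 0 0 - 1 ∈ A
      rw [e]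
      have h : M.1 0 0 * N.1 0 0 + M.1 0 1 * N.1 1 0 - 1
          = (M.1 0 0 - 1) * N.1 0 0 + (N.1 0 0 - 1) + M.1 0 1 * N.1 1 0 := by ring
      rw [h]
      exact A.add_mem (A.add_mem (A.mul_mem_right _ hM1) hN1) (A.mul_mem_left _ hN0)
    · show (M * N).1 1 1 - 1 ∈ A
      rw [e]
      have h : M.1 1 0 * N.1 0 1 + M.1 1 1 * N.1 1 1 - 1
          = (M.1 1 1 - 1) * N.1 1 1 + (N.1 1 1 - 1) + M.1 1 0 * N.1 0 1 := by ring
      rw [h]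
      exact A.add_mem (A.add_mem (A.mul_mem_right _ hM2) hN2) (A.mul_mem_right _ hM0)
  inv_mem' := by
    rintro M ⟨hM0, hM1, hM2⟩
    rw [Set.mem_setOf_eq, Matrix.SpecialLinearGroup.SL2_inv_expl M]
    refine ⟨?_, ?_, ?_⟩
    · simpa using A.neg_mem hM0
    · simpa using hM2
    · simpa using hM1

/-- The principal congruence subgroup `Γ(𝔞)` of `SL₂(R)`: matrices congruent to the
identity matrix modulo the ideal `𝔞` (all entries of `M - 1` lie in `𝔞`). -/
def GammaFull (A : Ideal R) : Subgroup (Matrix.SpecialLinearGroup (Fin 2) R) where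
  carrier := {M | M.1 0 0 - 1 ∈ A ∧ M.1 0 1 ∈ A ∧ M.1 1 0 ∈ A ∧ M.1 1 1 - 1 ∈ A}
  one_mem' := by
    refine ⟨?_, ?_, ?_, ?_⟩ <;>
      · show _ ∈ A
        simp
  mul_mem' := by
    rintro M N ⟨hM1, hM2, hM3, hM4⟩ ⟨hN1, hN2, hN3, hN4⟩
    have e : ∀ i j, (M * N).1 i j = M.1 i 0 * N.1 0 j + M.1 i 1 * N.1 1 j := by
      intro i j
      simp [Matrix.SpecialLinearGroup.coe_mul, Matrix.mul_apply, Fin.sum_univ_two]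
    refine ⟨?_, ?_, ?_, ?_⟩
    · show (M * N).1 0 0 - 1 ∈ A
      rw [e]
      have h : M.1 0 0 * N.1 0 0 + M.1 0 1 * N.1 1 0 - 1
          = (M.1 0 0 - 1) * N.1 0 0 + (N.1 0 0 - 1) + M.1 0 1 * N.1 1 0 := by ring
      rw [h]
      exact A.add_mem (A.add_mem (A.mul_mem_right _ hM1) hN1) (A.mul_mem_left _ hN3)
    · show (M * N).1 0 1 ∈ A
      rw [e]
      exact A.add_mem (A.mul_mem_left _ hN2) (A.mul_mem_right _ hM2)
    · show (M * N).1 1 0 ∈ A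
      rw [e]
      exact A.add_mem (A.mul_mem_right _ hM3) (A.mul_mem_left _ hN3)
    · show (M * N).1 1 1 - 1 ∈ A
      rw [e]
      have h : M.1 1 0 * N.1 0 1 + M.1 1 1 * N.1 1 1 - 1
          = (M.1 1 1 - 1) * N.1 1 1 + (N.1 1 1 - 1) + M.1 1 0 * N.1 0 1 := by ring
      rw [h]
      exact A.add_mem (A.add_mem (A.mul_mem_right _ hM4) hN4) (A.mul_mem_right _ hM3)
  inv_mem' := by
    rintro M ⟨hM1, hM2, hM3, hM4⟩
    rw [Set.mem_setOf_eq, Matrix.SpecialLinearGroup.SL2_inv_expl M]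
    refine ⟨?_, ?_, ?_, ?_⟩
    · simpa using hM4
    · simpa using A.neg_mem hM2
    · simpa using A.neg_mem hM3
    · simpa using hM1


section General
set_option linter.unusedSectionVars false

lemma gz_card_aux {G : Type*} [AddCommGroup G] [Finite G] {ι : Type*} [Fintype ι]
    (K : ι → Type*) [∀ i, AddCommGroup (K i)] (f : G →+ (∀ i, K i))
    (hf : Function.Surjective f) :
    (Nat.card {g : G // ∀ i, f g i ≠ 0} : ℚ) =
      Nat.card G * ∏ i, (1 - 1 / (Nat.card (K i) : ℚ)) := by
  classical
  have hfin : ∀ i, Finite (K i) := fun i =>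
    Finite.of_surjective (fun g => f g i) (fun y => by
      obtain ⟨g, hg⟩ := hf (Function.update 0 i y)
      exact ⟨g, by simp [hg]⟩)
  have key : ∀ s : (∀ i, K i) → Prop,
      Nat.card {g : G // s (f g)} = Nat.card f.ker * Nat.card {x // s x} := by
    intro s
    choose sec hsec using hf
    rw [← Nat.card_prod]
    refine Nat.card_congr
      { toFun := fun g => (⟨g.1 - sec (f g.1), by simp [AddMonoidHom.mem_ker, hsec]⟩, ⟨f g.1, g.2⟩)
        invFun := fun p => ⟨p.1.1 + sec p.2.1, by
          have h1 := (AddMonoidHom.mem_ker).1 p.1.2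
          rw [map_add, h1, hsec, zero_add]; exact p.2.2⟩
        left_inv := fun g => by simp
        right_inv := fun p => by
          obtain ⟨⟨a, ha⟩, ⟨b, hb⟩⟩ := p
          have h1 := (AddMonoidHom.mem_ker).1 ha
          simp [h1, hsec] }
  have h1 : Nat.card {g : G // ∀ i, f g i ≠ 0} =
      Nat.card f.ker * ∏ i, (Nat.card (K i) - 1) := by
    rw [key (fun x => ∀ i, x i ≠ 0)]
    congr 1
    rw [Nat.card_congr (Equiv.subtypePiEquivPi (p := fun i (x : K i) => x ≠ 0)), Nat.card_pi]
    refine Finset.prod_congr rfl fun i _ => ?_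
    have := Fintype.ofFinite (K i)
    rw [Nat.card_eq_fintype_card, Nat.card_eq_fintype_card, Fintype.card_subtype_compl]
    simp
  have h2 : Nat.card G = Nat.card f.ker * ∏ i, Nat.card (K i) := by
    have := key (fun _ => True)
    rw [Nat.card_congr (Equiv.subtypeUnivEquiv (fun _ => trivial)),
      Nat.card_congr (Equiv.subtypeUnivEquiv (fun _ => trivial)), Nat.card_pi] at this
    exact this
  rw [h1, h2]
  push_cast
  rw [mul_assoc, ← Finset.prod_mul_distrib]
  congr 1
  refine Finset.prod_congr rfl fun i _ => ?_
  have : 0 < Nat.card (K i) := Nat.card_pos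
  rw [Nat.cast_sub this]
  have : (Nat.card (K i) : ℚ) ≠ 0 := by positivity
  field_simp
  simp

variable (S : Type*) [CommRing S] [Finite S]

lemma gz_crt (x : ∀ m : MaximalSpectrum S, S) :
    ∃ r : S, ∀ m : MaximalSpectrum S, r - x m ∈ m.asIdeal := by
  refine Ideal.exists_forall_sub_mem_ideal (I := fun m : MaximalSpectrum S => m.asIdeal) ?_ x
  intro m n hmn
  exact Ideal.isCoprime_of_isMaximal (fun h => hmn (MaximalSpectrum.ext h))

lemma gz_isUnit (x : S) : IsUnit x ↔ ∀ m : MaximalSpectrum S, x ∉ m.asIdeal := by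
  constructor
  · intro h m hm
    exact m.isMaximal.ne_top (Ideal.eq_top_of_isUnit_mem _ hm h)
  · intro h
    by_contra hx
    obtain ⟨I, hI, hxI⟩ := exists_max_ideal_of_mem_nonunits hx
    exact h ⟨I, hI⟩ hxI

lemma gz_coprime (c d : S) : (∃ a b : S, a * d - b * c = 1) ↔
    ∀ m : MaximalSpectrum S, ¬ (c ∈ m.asIdeal ∧ d ∈ m.asIdeal) := by
  constructor
  · rintro ⟨a, b, h⟩ m ⟨hc, hd⟩
    apply m.isMaximal.ne_top
    rw [Ideal.eq_top_iff_one, ← h]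
    exact sub_mem (Ideal.mul_mem_left _ _ hd) (Ideal.mul_mem_left _ _ hc)
  · intro h
    by_contra hx
    have : Ideal.span {c, d} ≠ ⊤ := by
      intro h1
      rw [Ideal.eq_top_iff_one, Ideal.mem_span_pair] at h1
      obtain ⟨a, b, hab⟩ := h1
      exact hx ⟨b, -a, by rw [← hab]; ring⟩
    obtain ⟨I, hI, hle⟩ := Ideal.exists_le_maximal _ this
    exact h ⟨I, hI⟩ ⟨hle (Ideal.subset_span (by simp)), hle (Ideal.subset_span (by simp))⟩

noncomputable instance gz_ft : Fintype (MaximalSpectrum S) := Fintype.ofFinite _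

lemma gz_card_units : (Nat.card Sˣ : ℚ) =
    Nat.card S * ∏ m : MaximalSpectrum S, (1 - 1 / (Nat.card (S ⧸ m.asIdeal) : ℚ)) := by
  let f : S →+ (∀ m : MaximalSpectrum S, S ⧸ m.asIdeal) :=
    (RingHom.pi fun m : MaximalSpectrum S => Ideal.Quotient.mk m.asIdeal).toAddMonoidHom
  have hf : Function.Surjective f := by
    intro y
    choose x hx using fun m => Ideal.Quotient.mk_surjective (y m)
    obtain ⟨r, hr⟩ := gz_crt S x
    refine ⟨r, funext fun m => ?_⟩
    rw [← hx]
    exact Ideal.Quotient.eq.2 (hr m)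
  rw [← gz_card_aux _ f hf]
  congr 1
  have e : ∀ x : S, IsUnit x ↔ ∀ m, f x m ≠ 0 := by
    intro x
    rw [gz_isUnit]
    refine forall_congr' fun m => not_congr ?_
    exact Ideal.Quotient.eq_zero_iff_mem.symm
  rw [Nat.card_congr (Equiv.subtypeEquivRight e).symm]
  exact Nat.card_congr
    { toFun := fun u => ⟨u, u.isUnit⟩
      invFun := fun x => x.2.unit
      left_inv := fun u => by ext; simp
      right_inv := fun x => by simp }

lemma gz_card_unim : (Nat.card {p : S × S // ∃ a b : S, a * p.2 - b * p.1 = 1} : ℚ) =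
    (Nat.card S) ^ 2 *
      ∏ m : MaximalSpectrum S, (1 - 1 / (Nat.card (S ⧸ m.asIdeal) : ℚ) ^ 2) := by
  let f : S × S →+ (∀ m : MaximalSpectrum S, (S ⧸ m.asIdeal) × (S ⧸ m.asIdeal)) :=
    (RingHom.pi fun m : MaximalSpectrum S =>
      RingHom.prodMap (Ideal.Quotient.mk m.asIdeal) (Ideal.Quotient.mk m.asIdeal)).toAddMonoidHom
  have hf : Function.Surjective f := by
    intro y
    choose x hx using fun m => Ideal.Quotient.mk_surjective (y m).1
    choose x' hx' using fun m => Ideal.Quotient.mk_surjective (y m).2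
    obtain ⟨r, hr⟩ := gz_crt S x
    obtain ⟨r', hr'⟩ := gz_crt S x'
    refine ⟨(r, r'), funext fun m => Prod.ext ?_ ?_⟩
    · rw [← hx]
      exact Ideal.Quotient.eq.2 (hr m)
    · rw [← hx']
      exact Ideal.Quotient.eq.2 (hr' m)
  have := gz_card_aux _ f hf
  simp only [Nat.card_prod, ← sq, Nat.cast_pow] at this
  rw [← this]
  congr 1
  refine Nat.card_congr (Equiv.subtypeEquivRight fun p => ?_)
  rw [gz_coprime]
  refine forall_congr' fun m => not_congr ?_
  rw [← Ideal.Quotient.eq_zero_iff_mem, ← Ideal.Quotient.eq_zero_iff_mem]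
  exact (Prod.ext_iff (x := f p m) (y := 0)).symm

abbrev gzU := {p : S × S // ∃ a b : S, a * p.2 - b * p.1 = 1}


lemma gz_card_SL : Nat.card (Matrix.SpecialLinearGroup (Fin 2) S) =
    Nat.card (gzU S) * Nat.card S := by
  rw [← Nat.card_prod]
  choose a0 b0 h0 using fun p : gzU S => p.2
  refine Nat.card_congr
    { toFun := fun M => (⟨(M.1 1 0, M.1 1 1), M.1 0 0, M.1 0 1, by
          have := M.2; rwa [Matrix.det_fin_two] at this⟩,
          a0 ⟨(M.1 1 0, M.1 1 1), M.1 0 0, M.1 0 1, by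
            have := M.2; rwa [Matrix.det_fin_two] at this⟩ * M.1 0 1 -
          b0 ⟨(M.1 1 0, M.1 1 1), M.1 0 0, M.1 0 1, by
            have := M.2; rwa [Matrix.det_fin_two] at this⟩ * M.1 0 0)
      invFun := fun q => ⟨!![a0 q.1 + q.2 * q.1.1.1, b0 q.1 + q.2 * q.1.1.2; q.1.1.1, q.1.1.2], by
        rw [Matrix.det_fin_two_of]; linear_combination h0 q.1⟩
      left_inv := fun M => ?_
      right_inv := fun q => ?_ }
  · have hM := M.2
    rw [Matrix.det_fin_two] at hM
    have hq := h0 ⟨(M.1 1 0, M.1 1 1), M.1 0 0, M.1 0 1, hM⟩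
    ext i j
    fin_cases i <;> fin_cases j <;> simp at hM hq ⊢
    · linear_combination (M.1 0 0) * hq - a0 ⟨(M.1 1 0, M.1 1 1), M.1 0 0, M.1 0 1, hM⟩ * hM
    · linear_combination (M.1 0 1) * hq - b0 ⟨(M.1 1 0, M.1 1 1), M.1 0 0, M.1 0 1, hM⟩ * hM
  · obtain ⟨⟨⟨c, d⟩, hq⟩, t⟩ := q
    have := h0 ⟨(c, d), hq⟩
    simp at this ⊢
    linear_combination t * this


lemma gz_card_B : Nat.card (GammaZero S ⊥) = Nat.card Sˣ * Nat.card S := by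
  rw [← Nat.card_prod]
  refine Nat.card_congr
    { toFun := fun M => (⟨M.1.1 0 0, M.1.1 1 1, ?_, ?_⟩, M.1.1 0 1)
      invFun := fun q => ⟨⟨!![(q.1 : S), q.2; 0, ((q.1⁻¹ : Sˣ) : S)], by
        rw [Matrix.det_fin_two_of]; simp⟩, ?_⟩
      left_inv := fun M => ?_
      right_inv := fun q => ?_ }
  · have h := M.1.2
    have h2 : M.1.1 1 0 = 0 := M.2
    rw [Matrix.det_fin_two, h2] at h
    linear_combination h
  · have h := M.1.2
    have h2 : M.1.1 1 0 = 0 := M.2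
    rw [Matrix.det_fin_two, h2] at h
    linear_combination h
  · show _ ∈ (⊥ : Ideal S)
    simp
  · have h2 : M.1.1 1 0 = 0 := M.2
    ext i j
    fin_cases i <;> fin_cases j <;> simp
    exact h2.symm
  · ext <;> simp

lemma gz_index_bot : ((GammaZero S ⊥).index : ℚ) =
    Nat.card S * ∏ m : MaximalSpectrum S, (1 + 1 / (Nat.card (S ⧸ m.asIdeal) : ℚ)) := by
  have h := (GammaZero S ⊥).card_mul_index
  rw [gz_card_B, gz_card_SL] at h
  have hS : (Nat.card S : ℚ) ≠ 0 := by
    have : 0 < Nat.card S := Nat.card_pos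
    positivity
  have hU : (Nat.card Sˣ : ℚ) ≠ 0 := by
    have : 0 < Nat.card Sˣ := Nat.card_pos
    positivity
  have h' : (Nat.card Sˣ : ℚ) * (GammaZero S ⊥).index = Nat.card (gzU S) := by
    have : ((Nat.card Sˣ * Nat.card S * (GammaZero S ⊥).index : ℕ) : ℚ) =
      ((Nat.card (gzU S) * Nat.card S : ℕ) : ℚ) := by rw [h]
    push_cast at this
    apply mul_right_cancel₀ hS
    linear_combination this
  apply mul_left_cancel₀ hU
  rw [h', gz_card_unim, gz_card_units]
  have : ∏ m : MaximalSpectrum S, (1 - 1 / (Nat.card (S ⧸ m.asIdeal) : ℚ) ^ 2) =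
    (∏ m : MaximalSpectrum S, (1 - 1 / (Nat.card (S ⧸ m.asIdeal) : ℚ))) *
    (∏ m : MaximalSpectrum S, (1 + 1 / (Nat.card (S ⧸ m.asIdeal) : ℚ))) := by
    rw [← Finset.prod_mul_distrib]
    refine Finset.prod_congr rfl fun m _ => ?_
    ring
  rw [this]; ring

/-- elementary matrices -/
def gzE {T : Type*} [CommRing T] (x : T) : Matrix.SpecialLinearGroup (Fin 2) T :=
  ⟨!![1, x; 0, 1], by simp [Matrix.det_fin_two_of]⟩
def gzF {T : Type*} [CommRing T] (x : T) : Matrix.SpecialLinearGroup (Fin 2) T :=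
  ⟨!![1, 0; x, 1], by simp [Matrix.det_fin_two_of]⟩

lemma gzE_coe {T : Type*} [CommRing T] (x : T) :
    ((gzE x : Matrix.SpecialLinearGroup (Fin 2) T) : Matrix (Fin 2) (Fin 2) T) = !![1, x; 0, 1] := rfl
lemma gzF_coe {T : Type*} [CommRing T] (x : T) :
    ((gzF x : Matrix.SpecialLinearGroup (Fin 2) T) : Matrix (Fin 2) (Fin 2) T) = !![1, 0; x, 1] := rfl

lemma gz_closure (H : Subgroup (Matrix.SpecialLinearGroup (Fin 2) S))
    (hE : ∀ x, gzE x ∈ H) (hF : ∀ x, gzF x ∈ H) : H = ⊤ := by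
  classical
  have hunit : ∀ M : Matrix.SpecialLinearGroup (Fin 2) S, IsUnit (M.1 1 1) → M ∈ H := by
    intro M hu
    obtain ⟨v, hv⟩ := hu.exists_right_inv
    have hM := M.2
    rw [Matrix.det_fin_two] at hM
    have : M = gzE (M.1 0 1 * v) * ((gzE v * gzF (-(M.1 1 1)) * gzE v) *
        (gzE (-1) * gzF 1 * gzE (-1))) * gzF (v * M.1 1 0) := by
      ext i j
      fin_cases i <;> fin_cases j <;>
        simp [gzE_coe, gzF_coe, Matrix.SpecialLinearGroup.coe_mul, Matrix.mul_apply, Fin.sum_univ_two] <;> grind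
    rw [this]
    exact mul_mem (mul_mem (hE _) (mul_mem (mul_mem (mul_mem (hE _) (hF _)) (hE _))
      (mul_mem (mul_mem (hE _) (hF _)) (hE _)))) (hF _)
  rw [eq_top_iff]
  intro M _
  have hM := M.2
  rw [Matrix.det_fin_two] at hM
  obtain ⟨t, ht⟩ := gz_crt S (fun m => if M.1 1 1 ∈ m.asIdeal then 1 else 0)
  have h1 : M * gzE t ∈ H := by
    apply hunit
    have e : (M * gzE t).1 1 1 = M.1 1 0 * t + M.1 1 1 := by
      simp [gzE_coe, Matrix.SpecialLinearGroup.coe_mul, Matrix.mul_apply, Fin.sum_univ_two]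
    rw [e, gz_isUnit]
    intro m hm
    have := (gz_coprime S (M.1 1 0) (M.1 1 1)).1 ⟨_, _, hM⟩ m
    have htm := ht m
    split_ifs at htm with h
    · apply this ⟨?_, h⟩
      have h3 := sub_mem (sub_mem hm h) (Ideal.mul_mem_left _ (M.1 1 0) htm)
      convert h3 using 1
      ring
    · apply h
      rw [sub_zero] at htm
      have h3 := sub_mem hm (Ideal.mul_mem_left _ (M.1 1 0) htm)
      convert h3 using 1
      ring
  exact (H.mul_mem_cancel_right (hE t)).1 h1

end General

lemma gz_index {T : Type*} [CommRing T] (A : Ideal T) [Finite (T ⧸ A)] :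
    ((GammaZero T A).index : ℚ) =
    Nat.card (T ⧸ A) * ∏ m : MaximalSpectrum (T ⧸ A),
      (1 + 1 / (Nat.card ((T ⧸ A) ⧸ m.asIdeal) : ℚ)) := by
  rw [← gz_index_bot]
  congr 1
  let φ := Matrix.SpecialLinearGroup.map (n := Fin 2) (Ideal.Quotient.mk A)
  have hφ : Function.Surjective φ := by
    rw [← MonoidHom.range_eq_top]
    apply gz_closure
    · intro x
      obtain ⟨y, rfl⟩ := Ideal.Quotient.mk_surjective x
      refine ⟨gzE y, ?_⟩
      ext i j
      fin_cases i <;> fin_cases j <;> simp [φ, gzE_coe]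
    · intro x
      obtain ⟨y, rfl⟩ := Ideal.Quotient.mk_surjective x
      refine ⟨gzF y, ?_⟩
      ext i j
      fin_cases i <;> fin_cases j <;> simp [φ, gzF_coe]
  rw [← Subgroup.index_comap_of_surjective _ hφ]
  congr 1
  ext M
  show M.1 1 0 ∈ A ↔ Ideal.Quotient.mk A (M.1 1 0) ∈ (⊥ : Ideal _)
  rw [Ideal.mem_bot, Ideal.Quotient.eq_zero_iff_mem]

section Order

variable (d : ℤ)

/-- reduction of the first coordinate -/
def gzf1 (p : ℕ) : Od d →+* ZMod p :=
  (Int.castRingHom (ZMod p)).comp ((RingHom.fst ℤ ℤ).comp (Od d).subtype)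
/-- reduction of the second coordinate -/
def gzf2 (p : ℕ) : Od d →+* ZMod p :=
  (Int.castRingHom (ZMod p)).comp ((RingHom.snd ℤ ℤ).comp (Od d).subtype)

lemma gz_mem1 (p : ℕ) (z : Od d) : z ∈ RingHom.ker (gzf1 d p) ↔ (p : ℤ) ∣ z.1.1 := by
  rw [RingHom.mem_ker]
  exact ZMod.intCast_zmod_eq_zero_iff_dvd _ _

lemma gz_mem2 (p : ℕ) (z : Od d) : z ∈ RingHom.ker (gzf2 d p) ↔ (p : ℤ) ∣ z.1.2 := by
  rw [RingHom.mem_ker]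
  exact ZMod.intCast_zmod_eq_zero_iff_dvd _ _

lemma gz_surj (p : ℕ) (f : Od d →+* ZMod p) : Function.Surjective f := by
  intro x
  obtain ⟨n, rfl⟩ := ZMod.intCast_surjective x
  exact ⟨n, map_intCast _ _⟩

lemma gz_max (p : ℕ) [Fact p.Prime] (f : Od d →+* ZMod p) : (RingHom.ker f).IsMaximal :=
  RingHom.ker_isMaximal_of_surjective f (gz_surj d p f)

lemma gz_card (p : ℕ) (f : Od d →+* ZMod p) : Nat.card (Od d ⧸ RingHom.ker f) = p := by
  rw [Nat.card_congr (RingHom.quotientKerEquivOfSurjective (gz_surj d p f)).toEquiv, Nat.card_zmod]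

/-- the element `(d, 0)` -/
def gzv : Od d := ⟨(d, 0), mem_Od.mpr ⟨1, by ring⟩⟩

lemma gz_dec1 (z : Od d) : ∃ k : ℤ, z = (z.1.1 : Od d) + k * wd d := by
  obtain ⟨k, hk⟩ := mem_Od.1 z.2
  refine ⟨-k, Subtype.ext (Prod.ext ?_ ?_)⟩
  · simp [wd]
  · simp [wd]; linarith

lemma gz_dec2 (z : Od d) : ∃ k : ℤ, z = (z.1.2 : Od d) + k * gzv d := by
  obtain ⟨k, hk⟩ := mem_Od.1 z.2
  refine ⟨k, Subtype.ext (Prod.ext ?_ ?_)⟩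
  · simp [gzv]; linarith
  · simp [gzv]

lemma gz_classify (p : ℕ) [Fact p.Prime] (M : Ideal (Od d)) (hM : M.IsMaximal)
    (hp : (p : Od d) ∈ M) : M = RingHom.ker (gzf1 d p) ∨ M = RingHom.ker (gzf2 d p) := by
  have h0 : gzv d * wd d ∈ M := by
    have : gzv d * wd d = 0 := Subtype.ext (Prod.ext (by simp [gzv, wd]) (by simp [gzv, wd]))
    rw [this]; exact M.zero_mem
  have hpint : ∀ n : ℤ, (p : ℤ) ∣ n → (n : Od d) ∈ M := by
    rintro n ⟨k, rfl⟩
    push_cast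
    exact M.mul_mem_right _ hp
  rcases hM.isPrime.mem_or_mem h0 with h | h
  · right
    refine ((gz_max d p (gzf2 d p)).eq_of_le hM.ne_top ?_).symm
    intro z hz
    rw [gz_mem2] at hz
    obtain ⟨k, hk⟩ := gz_dec2 d z
    rw [hk]
    exact M.add_mem (hpint _ hz) (M.mul_mem_left _ h)
  · left
    refine ((gz_max d p (gzf1 d p)).eq_of_le hM.ne_top ?_).symm
    intro z hz
    rw [gz_mem1] at hz
    obtain ⟨k, hk⟩ := gz_dec1 d z
    rw [hk]
    exact M.add_mem (hpint _ hz) (M.mul_mem_left _ h)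

lemma gz_eq_of_dvd (p : ℕ) (h : (p : ℤ) ∣ d) :
    RingHom.ker (gzf1 d p) = RingHom.ker (gzf2 d p) := by
  ext z
  rw [gz_mem1, gz_mem2]
  exact (dvd_iff_dvd_of_dvd_sub (h.trans (mem_Od.1 z.2)))

lemma gz_ne_of_not_dvd (p : ℕ) (h : ¬ (p : ℤ) ∣ d) :
    RingHom.ker (gzf1 d p) ≠ RingHom.ker (gzf2 d p) := by
  intro he
  have : wd d ∈ RingHom.ker (gzf1 d p) := by rw [gz_mem1]; simp [wd]
  rw [he, gz_mem2] at this
  exact h this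

lemma gz_inf (p : ℕ) (hp : p.Prime) (h : ¬ (p : ℤ) ∣ d) (A : Ideal (Od d)) :
    A ≤ Ideal.span {(p : Od d)} ↔ A ≤ RingHom.ker (gzf1 d p) ∧ A ≤ RingHom.ker (gzf2 d p) := by
  rw [← le_inf_iff]
  suffices hh : Ideal.span {(p : Od d)} = RingHom.ker (gzf1 d p) ⊓ RingHom.ker (gzf2 d p) by rw [hh]
  ext z
  rw [Ideal.mem_inf, gz_mem1, gz_mem2, Ideal.mem_span_singleton]
  constructor
  · rintro ⟨w, rfl⟩
    exact ⟨⟨w.1.1, by simp⟩, ⟨w.1.2, by simp⟩⟩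
  · rintro ⟨⟨a, ha⟩, ⟨b, hb⟩⟩
    have h1 := mem_Od.1 z.2
    rw [ha, hb, ← mul_sub] at h1
    have hc : IsCoprime d (p : ℤ) :=
      ((Prime.coprime_iff_not_dvd (Nat.prime_iff_prime_int.1 hp)).2 h).symm
    exact ⟨⟨(a, b), mem_Od.2 (hc.dvd_of_dvd_mul_left h1)⟩,
      Subtype.ext (Prod.ext (by simpa using ha) (by simpa using hb))⟩

lemma gz_finite (A : Ideal (Od d))
    (hreg : ∃ z ∈ A, ((z : ℤ × ℤ)) ∈ nonZeroDivisors (ℤ × ℤ)) : Finite (Od d ⧸ A) := by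
  obtain ⟨z, hz, hz0⟩ := hreg
  have ha : z.1.1 ≠ 0 := by
    intro h
    have := (mem_nonZeroDivisors_iff.1 hz0).2 (1, 0) (Prod.ext (by simp [h]) (by simp))
    simp at this
  have hb : z.1.2 ≠ 0 := by
    intro h
    have := (mem_nonZeroDivisors_iff.1 hz0).2 (0, 1) (Prod.ext (by simp) (by simp [h]))
    simp at this
  obtain ⟨k, hk⟩ := mem_Od.1 z.2
  have hn : ((z.1.1 * z.1.2 : ℤ) : Od d) ∈ A := by
    have : ((z.1.1 * z.1.2 : ℤ) : Od d) =
        (⟨(z.1.2, z.1.1), mem_Od.2 ⟨-k, by simp; linarith⟩⟩ : Od d) * z :=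
      Subtype.ext (Prod.ext (by simp [mul_comm]) (by simp))
    rw [this]; exact A.mul_mem_left _ hz
  set n : ℤ := z.1.1 * z.1.2 with hndef
  have hn0 : n ≠ 0 := mul_ne_zero ha hb
  have hred : ∀ x : ℤ, ((x : Od d) : Od d) - ((x % n : ℤ) : Od d) ∈ A := by
    intro x
    rw [← Int.cast_sub, show x - x % n = n * (x / n) by have := Int.emod_add_mul_ediv x n; linarith]
    push_cast
    exact A.mul_mem_right _ hn
  refine Finite.of_surjective
    (fun q : Set.Ico 0 |n| × Set.Ico 0 |n| =>
      Ideal.Quotient.mk A ((q.1.1 : ℤ) + ((q.2.1 : ℤ) : Od d) * wd d)) ?_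
  intro y
  obtain ⟨y, rfl⟩ := Ideal.Quotient.mk_surjective y
  obtain ⟨k, hk⟩ := gz_dec1 d y
  refine ⟨(⟨y.1.1 % n, Int.emod_nonneg _ hn0, Int.emod_lt_abs _ hn0⟩,
    ⟨k % n, Int.emod_nonneg _ hn0, Int.emod_lt_abs _ hn0⟩), ?_⟩
  conv_rhs => rw [hk]
  symm
  rw [Ideal.Quotient.eq]
  have h1 := A.add_mem (hred y.1.1) (A.mul_mem_left (wd d) (hred k))
  convert h1 using 1
  ring

variable (A : Ideal (Od d)) [Finite (Od d ⧸ A)]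

lemma gz_card_comap (m : MaximalSpectrum (Od d ⧸ A)) :
    Nat.card ((Od d ⧸ A) ⧸ m.asIdeal) =
      Nat.card (Od d ⧸ m.asIdeal.comap (Ideal.Quotient.mk A)) := by
  let f := (Ideal.Quotient.mk m.asIdeal).comp (Ideal.Quotient.mk A)
  have hf : Function.Surjective f :=
    Ideal.Quotient.mk_surjective.comp Ideal.Quotient.mk_surjective
  have hk : RingHom.ker f = m.asIdeal.comap (Ideal.Quotient.mk A) := by
    rw [← RingHom.comap_ker, Ideal.mk_ker]
  rw [← hk]
  exact (Nat.card_congr (RingHom.quotientKerEquivOfSurjective hf).toEquiv).symm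

lemma gz_comap_max (m : MaximalSpectrum (Od d ⧸ A)) :
    (m.asIdeal.comap (Ideal.Quotient.mk A)).IsMaximal :=
  have := m.isMaximal
  Ideal.comap_isMaximal_of_surjective _ Ideal.Quotient.mk_surjective

lemma gz_of_mem (m : MaximalSpectrum (Od d ⧸ A)) (p : ℕ) (hp : p.Prime)
    (h : (p : Od d ⧸ A) ∈ m.asIdeal) :
    (m.asIdeal.comap (Ideal.Quotient.mk A) = RingHom.ker (gzf1 d p) ∨
      m.asIdeal.comap (Ideal.Quotient.mk A) = RingHom.ker (gzf2 d p)) ∧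
    Nat.card ((Od d ⧸ A) ⧸ m.asIdeal) = p := by
  have : Fact p.Prime := ⟨hp⟩
  have h1 := gz_classify d p _ (gz_comap_max d A m) (by
    rw [Ideal.mem_comap, map_natCast]; exact h)
  refine ⟨h1, ?_⟩
  rw [gz_card_comap]
  rcases h1 with h1 | h1 <;> rw [h1] <;> exact gz_card d p _

lemma gz_prime (m : MaximalSpectrum (Od d ⧸ A)) :
    ∃ p : ℕ, p.Prime ∧ (p : Od d ⧸ A) ∈ m.asIdeal := by
  have := m.isMaximal
  letI : Field ((Od d ⧸ A) ⧸ m.asIdeal) := Ideal.Quotient.field _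
  have : Finite ((Od d ⧸ A) ⧸ m.asIdeal) :=
    Finite.of_surjective _ (Ideal.Quotient.mk_surjective (I := m.asIdeal))
  obtain ⟨p, hp⟩ := CharP.exists ((Od d ⧸ A) ⧸ m.asIdeal)
  refine ⟨p, CharP.char_is_prime ((Od d ⧸ A) ⧸ m.asIdeal) p, ?_⟩
  rw [← Ideal.Quotient.eq_zero_iff_mem, map_natCast]
  exact CharP.cast_eq_zero _ p

lemma gz_exists (p : ℕ) (hp : p.Prime) (h : p ∣ Nat.card (Od d ⧸ A)) :
    ∃ m : MaximalSpectrum (Od d ⧸ A), (p : Od d ⧸ A) ∈ m.asIdeal := by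
  have : Fact p.Prime := ⟨hp⟩
  have := Fintype.ofFinite (Od d ⧸ A)
  rw [Nat.card_eq_fintype_card] at h
  obtain ⟨x, hx⟩ := exists_prime_addOrderOf_dvd_card p h
  have hu : ¬ IsUnit (p : Od d ⧸ A) := by
    intro hu
    have h1 := addOrderOf_nsmul_eq_zero x
    rw [hx, nsmul_eq_mul, hu.mul_right_eq_zero] at h1
    rw [h1, addOrderOf_zero] at hx
    exact hp.one_lt.ne hx
  obtain ⟨I, hI, hxI⟩ := exists_max_ideal_of_mem_nonunits hu
  exact ⟨⟨I, hI⟩, hxI⟩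

open scoped Classical in
lemma gz_fiber (p : ℕ) (hp : p.Prime) :
    (Finset.univ.filter (fun m : MaximalSpectrum (Od d ⧸ A) =>
      Nat.card ((Od d ⧸ A) ⧸ m.asIdeal) = p)).card =
    (({RingHom.ker (gzf1 d p), RingHom.ker (gzf2 d p)} : Finset (Ideal (Od d))).filter
      (fun P => A ≤ P)).card := by
  have : Fact p.Prime := ⟨hp⟩
  have hinj : Function.Injective (fun m : MaximalSpectrum (Od d ⧸ A) =>
      m.asIdeal.comap (Ideal.Quotient.mk A)) := by
    intro m n hmn
    exact MaximalSpectrum.ext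
      (Ideal.comap_injective_of_surjective _ Ideal.Quotient.mk_surjective hmn)
  rw [← Finset.card_image_of_injective _ hinj]
  congr 1
  ext P
  simp only [Finset.mem_image, Finset.mem_filter, Finset.mem_univ, true_and, Finset.mem_insert,
    Finset.mem_singleton]
  constructor
  · rintro ⟨m, hm, rfl⟩
    obtain ⟨q, hq, hqm⟩ := gz_prime d A m
    obtain ⟨h1, h2⟩ := gz_of_mem d A m q hq hqm
    rw [hm] at h2
    subst h2
    refine ⟨h1, ?_⟩
    conv_lhs => rw [← Ideal.mk_ker (I := A)]
    exact Ideal.comap_mono bot_le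
  · rintro ⟨h1, hA⟩
    have hmax : P.IsMaximal := by
      rcases h1 with rfl | rfl <;> exact gz_max d p _
    have hcm : Ideal.comap (Ideal.Quotient.mk A) (Ideal.map (Ideal.Quotient.mk A) P) = P :=
      Ideal.comap_map_mk hA
    have hm : (Ideal.map (Ideal.Quotient.mk A) P).IsMaximal := by
      rcases Ideal.map_eq_top_or_isMaximal_of_surjective (Ideal.Quotient.mk A)
        Ideal.Quotient.mk_surjective hmax with h | h
      · rw [h, Ideal.comap_top] at hcm
        exact absurd hcm.symm hmax.ne_top
      · exact h
    refine ⟨⟨_, hm⟩, ?_, hcm⟩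
    rw [gz_card_comap, hcm]
    rcases h1 with rfl | rfl <;> exact gz_card d p _

open scoped Classical in
lemma gz_count (p : ℕ) (hp : p.Prime) (h : p ∣ Nat.card (Od d ⧸ A)) :
    (Finset.univ.filter (fun m : MaximalSpectrum (Od d ⧸ A) =>
      Nat.card ((Od d ⧸ A) ⧸ m.asIdeal) = p)).card =
    if ¬ ((p : ℤ) ∣ d ^ 2) ∧ A ≤ Ideal.span {(p : Od d)} then 2 else 1 := by
  have hpos : 0 < (Finset.univ.filter (fun m : MaximalSpectrum (Od d ⧸ A) =>
      Nat.card ((Od d ⧸ A) ⧸ m.asIdeal) = p)).card := by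
    obtain ⟨m, hm⟩ := gz_exists d A p hp h
    exact Finset.card_pos.2 ⟨m, by simpa using (gz_of_mem d A m p hp hm).2⟩
  rw [gz_fiber d A p hp] at hpos ⊢
  have hd2 : (p : ℤ) ∣ d ^ 2 ↔ (p : ℤ) ∣ d :=
    (Nat.prime_iff_prime_int.1 hp).dvd_pow_iff_dvd two_ne_zero
  by_cases hpd : (p : ℤ) ∣ d
  · rw [if_neg (by rw [hd2]; simp [hpd])]
    rw [gz_eq_of_dvd d p hpd] at hpos ⊢
    refine le_antisymm ((Finset.card_filter_le _ _).trans (by simp)) hpos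
  · have hne := gz_ne_of_not_dvd d p hpd
    have hinf := gz_inf d p hp hpd A
    rw [Finset.filter_insert, Finset.filter_singleton] at hpos ⊢
    by_cases h1 : A ≤ RingHom.ker (gzf1 d p) <;> by_cases h2 : A ≤ RingHom.ker (gzf2 d p) <;>
      simp_all

end Order

open scoped Classical in
/-- Theorem 2.8 (i): for a regular ideal `𝔞` of `𝒪_D`, the index of
`Γ₀^D(𝔞)` in `SL₂(𝒪_D)` equals `N(𝔞) · ∏_{p ∣ N(𝔞)} (1 + 1/p)^{c_p(𝔞)}`, where the product
runs over the prime numbers `p` dividing `N(𝔞)` and `c_p(𝔞) = 2` if `p ∤ D = d²` and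
`𝔞 ⊆ (p)`, and `c_p(𝔞) = 1` otherwise. -/
theorem index_gamma_zero (d : ℤ) (hd : 1 ≤ d) (A : Ideal (Od d))
    (hreg : ∃ z ∈ A, ((z : ℤ × ℤ)) ∈ nonZeroDivisors (ℤ × ℤ)) :
    ((GammaZero (Od d) A).index : ℚ) =
      (Nat.card (Od d ⧸ A) : ℚ) *
        ∏ᶠ p ∈ {p : ℕ | p.Prime ∧ p ∣ Nat.card (Od d ⧸ A)},
          (1 + 1 / (p : ℚ)) ^
            (if ¬ ((p : ℤ) ∣ d ^ 2) ∧ A ≤ Ideal.span {(p : Od d)} then 2 else 1) := by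
  have := gz_finite d A hreg
  rw [gz_index]
  congr 1
  have hset : {p : ℕ | p.Prime ∧ p ∣ Nat.card (Od d ⧸ A)} =
      ((Nat.card (Od d ⧸ A)).primeFactors : Set ℕ) := by
    ext p
    have : Nat.card (Od d ⧸ A) ≠ 0 := Nat.card_pos.ne'
    simp [Nat.mem_primeFactors, this]
  rw [hset, finprod_mem_coe_finset]
  rw [← Finset.prod_fiberwise_of_maps_to (s := Finset.univ)
    (t := (Nat.card (Od d ⧸ A)).primeFactors)
    (g := fun m : MaximalSpectrum (Od d ⧸ A) => Nat.card ((Od d ⧸ A) ⧸ m.asIdeal))]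
  · refine Finset.prod_congr rfl fun p hp => ?_
    rw [← gz_count d A p (Nat.prime_of_mem_primeFactors hp) (Nat.dvd_of_mem_primeFactors hp),
      ← Finset.prod_const]
    refine Finset.prod_congr rfl fun m hm => ?_
    rw [(Finset.mem_filter.1 hm).2]
  · intro m _
    obtain ⟨q, hq, hqm⟩ := gz_prime d A m
    have h2 := (gz_of_mem d A m q hq hqm).2
    rw [Nat.mem_primeFactors]
    refine ⟨h2 ▸ hq, ?_, Nat.card_pos.ne'⟩
    exact AddSubgroup.card_quotient_dvd_card m.asIdeal.toAddSubgroup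
end

section
/- Let 𝔞 be a regular ideal of 𝒪_D. Then the index of the principal congruence subgroup Γ^D(𝔞) in SL₂(𝒪_D) equals N(𝔞)³ · ∏_{p ∣ N(𝔞)} (1 − 1/p²)^{c_p(𝔞)}, where the product runs over all prime numbers p dividing N(𝔞), and c_p(𝔞) = 2 if p ∤ D and 𝔞 ⊆ p·𝒪_D, while c_p(𝔞) = 1 otherwise; the equality is of rational numbers. -/
open Matrix

variable (R : Type*) [CommRing R]

namespace GF

open Matrix

/-- Fibre counting for a surjective additive homomorphism. -/
lemma card_preimage_mul {α β : Type*} [AddCommGroup α] [AddCommGroup β] [Finite α] [Finite β]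
    (f : α →+ β) (hf : Function.Surjective f) (T : Set β) :
    Nat.card (f ⁻¹' T) * Nat.card β = Nat.card α * Nat.card T := by
  have key : ∀ T : Set β, Nat.card (f ⁻¹' T) = Nat.card f.ker * Nat.card T := by
    intro T
    choose s hs using hf
    rw [← Nat.card_prod]
    refine Nat.card_congr
      { toFun := fun x => (⟨x.1 - s (f x.1), by simp [AddMonoidHom.mem_ker, hs]⟩, ⟨f x.1, x.2⟩)
        invFun := fun y => ⟨y.1.1 + s y.2.1, by
          have := y.1.2
          rw [AddMonoidHom.mem_ker] at this
          simp [hs, this]⟩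
        left_inv := fun x => by simp
        right_inv := fun y => by
          obtain ⟨⟨a, ha⟩, ⟨b, hb⟩⟩ := y
          rw [AddMonoidHom.mem_ker] at ha
          simp [hs, ha] }
  have h1 := key Set.univ
  rw [Set.preimage_univ, Nat.card_univ, Nat.card_univ] at h1
  rw [key T, h1]
  ring

section ring
variable {S : Type*} [CommRing S]

lemma maxs_coprime : Pairwise (Function.onFun IsCoprime
    (fun m : MaximalSpectrum S => m.asIdeal)) := by
  intro m n hmn
  have := m.isMaximal
  have := n.isMaximal
  exact Ideal.isCoprime_of_isMaximal (fun h => hmn (MaximalSpectrum.ext h))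

/-- A pair is unimodular iff it does not vanish modulo any maximal ideal. -/
lemma unimod_iff (c e : S) : (∃ a b : S, a * e - b * c = 1) ↔
    ∀ m : MaximalSpectrum S, ¬ (c ∈ m.asIdeal ∧ e ∈ m.asIdeal) := by
  constructor
  · rintro ⟨a, b, h⟩ m ⟨hc, he⟩
    apply m.isMaximal.ne_top
    rw [Ideal.eq_top_iff_one, ← h]
    exact sub_mem (Ideal.mul_mem_left _ _ he) (Ideal.mul_mem_left _ _ hc)
  · intro h
    have : Ideal.span {c, e} = ⊤ := by
      by_contra hne
      obtain ⟨m, hm, hle⟩ := Ideal.exists_le_maximal _ hne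
      exact h ⟨m, hm⟩ ⟨hle (Ideal.subset_span (by simp)), hle (Ideal.subset_span (by simp))⟩
    rw [Ideal.eq_top_iff_one, Ideal.mem_span_pair] at this
    obtain ⟨b, a, hab⟩ := this
    exact ⟨a, -b, by rw [← hab]; ring⟩

lemma unimod_card [Finite S] [Fintype (MaximalSpectrum S)] :
    (Nat.card {v : S × S | ∀ m : MaximalSpectrum S, ¬ (v.1 ∈ m.asIdeal ∧ v.2 ∈ m.asIdeal)} : ℚ) =
      (Nat.card S : ℚ) ^ 2 *
        ∏ m : MaximalSpectrum S, (1 - 1 / (Nat.card (S ⧸ m.asIdeal) : ℚ) ^ 2) := by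
  have hfin : ∀ m : MaximalSpectrum S, Finite (S ⧸ m.asIdeal) := fun m =>
    Finite.of_surjective _ (Ideal.Quotient.mk_surjective (I := m.asIdeal))
  let f : S × S →+ ((m : MaximalSpectrum S) → (S ⧸ m.asIdeal) × (S ⧸ m.asIdeal)) :=
    { toFun := fun v m => (Ideal.Quotient.mk _ v.1, Ideal.Quotient.mk _ v.2)
      map_zero' := by ext <;> simp
      map_add' := by intro x y; ext <;> simp }
  have hf : Function.Surjective f := by
    intro y
    obtain ⟨r, hr⟩ := Ideal.pi_quotient_surjective (maxs_coprime (S := S)) (fun m => (y m).1)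
    obtain ⟨t, ht⟩ := Ideal.pi_quotient_surjective (maxs_coprime (S := S)) (fun m => (y m).2)
    exact ⟨(r, t), funext fun m => Prod.ext (hr m) (ht m)⟩
  have h := card_preimage_mul f hf (Set.pi Set.univ fun m => {0}ᶜ)
  have e1 : f ⁻¹' (Set.pi Set.univ fun m => {0}ᶜ) =
      {v : S × S | ∀ m : MaximalSpectrum S, ¬ (v.1 ∈ m.asIdeal ∧ v.2 ∈ m.asIdeal)} := by
    ext v
    simp only [Set.mem_preimage, Set.mem_pi, Set.mem_univ, true_imp_iff, Set.mem_compl_iff,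
      Set.mem_singleton_iff, Set.mem_ofPred_eq]
    refine forall_congr' fun m => not_congr ?_
    simp [f, Prod.ext_iff, Ideal.Quotient.eq_zero_iff_mem]
  have e2 : Nat.card (Set.pi Set.univ fun m : MaximalSpectrum S =>
      ({0}ᶜ : Set ((S ⧸ m.asIdeal) × (S ⧸ m.asIdeal)))) =
      ∏ m : MaximalSpectrum S, (Nat.card (S ⧸ m.asIdeal) ^ 2 - 1) := by
    rw [Nat.card_congr (Equiv.Set.univPi _), Nat.card_pi]
    refine Finset.prod_congr rfl fun m _ => ?_
    rw [Nat.card_coe_set_eq, Set.ncard_compl, Set.ncard_singleton, Nat.card_prod, sq]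
  rw [e1, e2, Nat.card_pi, Nat.card_prod] at h
  simp only [Nat.card_prod] at h
  have hpos : ∀ m : MaximalSpectrum S, 0 < Nat.card (S ⧸ m.asIdeal) := fun m => Nat.card_pos
  have h' := congrArg (Nat.cast : ℕ → ℚ) h
  push_cast at h'
  have hne : (∏ m : MaximalSpectrum S, ((Nat.card (S ⧸ m.asIdeal) : ℚ) *
      (Nat.card (S ⧸ m.asIdeal) : ℚ))) ≠ 0 :=
    Finset.prod_ne_zero_iff.mpr fun m _ => by
      have := hpos m
      positivity
  rw [← mul_left_inj' hne, h', mul_assoc (_ ^ 2), ← Finset.prod_mul_distrib, ← sq]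
  congr 1
  refine Finset.prod_congr rfl fun m _ => ?_
  have := hpos m
  rw [Nat.cast_sub (Nat.one_le_pow _ _ this)]
  push_cast
  field_simp

lemma card_fibre (c e : S) (a₀ b₀ : S) (h : a₀ * e - b₀ * c = 1) :
    Nat.card {w : S × S // w.1 * e - w.2 * c = 1} = Nat.card S := by
  refine Nat.card_congr
    { toFun := fun w => a₀ * w.1.2 - b₀ * w.1.1
      invFun := fun t => ⟨(a₀ + t * c, b₀ + t * e), by simp only; linear_combination h⟩
      left_inv := ?_
      right_inv := ?_ }
  · rintro ⟨⟨a, b⟩, hw⟩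
    simp only at hw
    ext
    · simp only; linear_combination a * h - a₀ * hw
    · simp only; linear_combination b * h - b₀ * hw
  · intro t
    simp only; linear_combination t * h

lemma card_SL2_aux [Finite S] : Nat.card (SpecialLinearGroup (Fin 2) S) =
    Nat.card {v : S × S | ∀ m : MaximalSpectrum S, ¬ (v.1 ∈ m.asIdeal ∧ v.2 ∈ m.asIdeal)} *
      Nat.card S := by
  have e : SpecialLinearGroup (Fin 2) S ≃
      Σ v : {v : S × S | ∀ m : MaximalSpectrum S, ¬ (v.1 ∈ m.asIdeal ∧ v.2 ∈ m.asIdeal)},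
        {w : S × S // w.1 * v.1.2 - w.2 * v.1.1 = 1} :=
    { toFun := fun M => ⟨⟨(M.1 1 0, M.1 1 1), (unimod_iff _ _).1
          ⟨M.1 0 0, M.1 0 1, by rw [← det_fin_two]; exact M.2⟩⟩,
          ⟨(M.1 0 0, M.1 0 1), (det_fin_two M.1).symm.trans M.2⟩⟩
      invFun := fun x => ⟨!![x.2.1.1, x.2.1.2; x.1.1.1, x.1.1.2], by
          rw [det_fin_two_of]; exact x.2.2⟩
      left_inv := fun M => by
        ext i j
        fin_cases i <;> fin_cases j <;> rfl
      right_inv := fun x => rfl }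
  have := Fintype.ofFinite {v : S × S | ∀ m : MaximalSpectrum S, ¬ (v.1 ∈ m.asIdeal ∧ v.2 ∈ m.asIdeal)}
  rw [Nat.card_congr e, Nat.card_sigma, Finset.sum_congr rfl (g := fun _ => Nat.card S)]
  · simp
  · intro v _
    obtain ⟨a, b, h⟩ := (unimod_iff _ _).2 v.2
    exact card_fibre _ _ a b h

lemma card_SL2 [Finite S] [Fintype (MaximalSpectrum S)] :
    (Nat.card (SpecialLinearGroup (Fin 2) S) : ℚ) = (Nat.card S : ℚ) ^ 3 *
        ∏ m : MaximalSpectrum S, (1 - 1 / (Nat.card (S ⧸ m.asIdeal) : ℚ) ^ 2) := by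
  rw [card_SL2_aux, Nat.cast_mul, unimod_card]
  ring

/-- Stable range one for finite rings. -/
lemma exists_unit [Finite S] (a c : S)
    (h : ∀ m : MaximalSpectrum S, ¬ (a ∈ m.asIdeal ∧ c ∈ m.asIdeal)) :
    ∃ t : S, IsUnit (a + t * c) := by
  classical
  obtain ⟨t, ht⟩ := Ideal.exists_forall_sub_mem_ideal (maxs_coprime (S := S))
    (fun m => if a ∈ m.asIdeal then 1 else 0)
  refine ⟨t, ?_⟩
  by_contra hu
  obtain ⟨m, hm, hmem⟩ := exists_max_ideal_of_mem_nonunits hu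
  have h1 := ht ⟨m, hm⟩
  have h2 := h ⟨m, hm⟩
  simp only at h1 h2
  by_cases ha : a ∈ m
  · rw [if_pos ha] at h1
    apply h2 ⟨ha, ?_⟩
    have : c = (a + t * c) - a - (t - 1) * c := by ring
    rw [this]
    exact sub_mem (sub_mem hmem ha) (Ideal.mul_mem_right _ _ h1)
  · rw [if_neg ha] at h1
    apply ha
    have : a = (a + t * c) - (t - 0) * c := by ring
    rw [this]
    exact sub_mem hmem (Ideal.mul_mem_right _ _ h1)

/-- Upper elementary matrix. -/
def U (t : S) : SpecialLinearGroup (Fin 2) S := ⟨!![1, t; 0, 1], by simp [det_fin_two_of]⟩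
/-- Lower elementary matrix. -/
def L (t : S) : SpecialLinearGroup (Fin 2) S := ⟨!![1, 0; t, 1], by simp [det_fin_two_of]⟩

lemma decomp [Finite S] (M : SpecialLinearGroup (Fin 2) S) :
    ∃ t s x y : S, M = U t * L s * U x * L 1 * U y := by
  have hdet : M.1 0 0 * M.1 1 1 - M.1 0 1 * M.1 1 0 = 1 := by rw [← det_fin_two]; exact M.2
  obtain ⟨t, ht⟩ := exists_unit (M.1 0 0) (M.1 1 0) (by
    apply (unimod_iff _ _).1
    exact ⟨-M.1 0 1, -M.1 1 1, by linear_combination hdet⟩)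
  obtain ⟨u, hu⟩ := ht
  obtain ⟨v, hv⟩ : ∃ v : S, v * (M.1 0 0 + t * M.1 1 0) = 1 :=
    ⟨(u⁻¹ : Sˣ), by rw [← hu]; simp⟩
  set a := M.1 0 0 with ha
  set b := M.1 0 1 with hb
  set c := M.1 1 0 with hc
  set e := M.1 1 1 with he
  let s := (1 - c) * v
  refine ⟨-t, -s, (a + t * c) - 1, e + s * (b + t * e) - 1, ?_⟩
  have hs : s * (a + t * c) = 1 - c := by
    simp only [s]; linear_combination (1 - c) * hv
  apply Subtype.ext
  have hM : M.1 = !![a, b; c, e] := by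
    rw [ha, hb, hc, he]
    exact eta_fin_two M.1
  rw [hM]
  change _ = (!![1, -t; 0, 1] * !![1, 0; -s, 1] * !![1, (a + t * c) - 1; 0, 1] * !![1, 0; 1, 1] *
    !![1, e + s * (b + t * e) - 1; 0, 1] : Matrix (Fin 2) (Fin 2) S)
  have hk : (a + t * c) * (e + s * (b + t * e)) = 1 + (b + t * e) := by
    linear_combination hdet + (b + t * e) * hs
  clear_value a b c e s
  simp only [Matrix.mul_fin_two]
  congr 1
  ext i j
  fin_cases i <;> fin_cases j <;> simp
  · linear_combination (-t) * hs
  · linear_combination (-(1 + t * s)) * hk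
  · linear_combination hs
  · linear_combination s * hk

lemma map_surj {T : Type*} [CommRing T] [Finite S] (f : T →+* S) (hf : Function.Surjective f) :
    Function.Surjective (SpecialLinearGroup.map (n := Fin 2) f) := by
  have hU : ∀ t : T, SpecialLinearGroup.map (n := Fin 2) f (U t) = U (f t) := by
    intro t
    apply Subtype.ext
    change (U t).1.map f = (U (f t)).1
    ext i j
    fin_cases i <;> fin_cases j <;> simp [U]
  have hL : ∀ t : T, SpecialLinearGroup.map (n := Fin 2) f (L t) = L (f t) := by
    intro t
    apply Subtype.ext
    change (L t).1.map f = (L (f t)).1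
    ext i j
    fin_cases i <;> fin_cases j <;> simp [L]
  intro M
  obtain ⟨t, s, x, y, rfl⟩ := decomp M
  obtain ⟨t, rfl⟩ := hf t
  obtain ⟨s, rfl⟩ := hf s
  obtain ⟨x, rfl⟩ := hf x
  obtain ⟨y, rfl⟩ := hf y
  exact ⟨U t * L s * U x * L 1 * U y, by simp only [map_mul, hU, hL, map_one]⟩

lemma gamma_eq_ker (A : Ideal S) :
    GammaFull S A = (SpecialLinearGroup.map (n := Fin 2) (Ideal.Quotient.mk A)).ker := by
  ext M
  have h1 : M ∈ GammaFull S A ↔ (M.1 0 0 - 1 ∈ A ∧ M.1 0 1 ∈ A ∧ M.1 1 0 ∈ A ∧ M.1 1 1 - 1 ∈ A) :=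
    Iff.rfl
  have h2 : M ∈ (SpecialLinearGroup.map (n := Fin 2) (Ideal.Quotient.mk A)).ker ↔
      M.1.map (Ideal.Quotient.mk A) = 1 := by
    rw [MonoidHom.mem_ker]
    exact Subtype.ext_iff
  rw [h1, h2, ← Matrix.ext_iff]
  simp [Fin.forall_fin_two, ← Ideal.Quotient.eq_zero_iff_mem, sub_eq_zero, and_assoc]

lemma index_gamma (A : Ideal S) [Finite (S ⧸ A)] [Fintype (MaximalSpectrum (S ⧸ A))] :
    ((GammaFull S A).index : ℚ) = (Nat.card (S ⧸ A) : ℚ) ^ 3 *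
      ∏ m : MaximalSpectrum (S ⧸ A), (1 - 1 / (Nat.card ((S ⧸ A) ⧸ m.asIdeal) : ℚ) ^ 2) := by
  rw [gamma_eq_ker, Subgroup.index_ker, MonoidHom.range_eq_top.mpr
    (map_surj _ Ideal.Quotient.mk_surjective), ← card_SL2]
  rw [Nat.card_congr (Subgroup.topEquiv).toEquiv]

end ring

section order
variable {d : ℤ}

/-- Reduction of the first coordinate modulo `p`. -/
def red1 (d : ℤ) (p : ℕ) : Od d →+* ZMod p :=
  (Int.castRingHom (ZMod p)).comp ((RingHom.fst ℤ ℤ).comp (Od d).subtype)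
/-- Reduction of the second coordinate modulo `p`. -/
def red2 (d : ℤ) (p : ℕ) : Od d →+* ZMod p :=
  (Int.castRingHom (ZMod p)).comp ((RingHom.snd ℤ ℤ).comp (Od d).subtype)

/-- The ideal of elements whose first coordinate is divisible by `p`. -/
def P1 (d : ℤ) (p : ℕ) : Ideal (Od d) := RingHom.ker (red1 d p)
/-- The ideal of elements whose second coordinate is divisible by `p`. -/
def P2 (d : ℤ) (p : ℕ) : Ideal (Od d) := RingHom.ker (red2 d p)

lemma mem_P1 {p : ℕ} {z : Od d} : z ∈ P1 d p ↔ (p : ℤ) ∣ z.1.1 := by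
  rw [P1, RingHom.mem_ker]
  exact ZMod.intCast_zmod_eq_zero_iff_dvd _ _

lemma mem_P2 {p : ℕ} {z : Od d} : z ∈ P2 d p ↔ (p : ℤ) ∣ z.1.2 := by
  rw [P2, RingHom.mem_ker]
  exact ZMod.intCast_zmod_eq_zero_iff_dvd _ _

lemma red1_surj (p : ℕ) : Function.Surjective (red1 d p) := by
  intro x
  obtain ⟨n, rfl⟩ := ZMod.intCast_surjective x
  exact ⟨(n : Od d), by simp⟩

lemma red2_surj (p : ℕ) : Function.Surjective (red2 d p) := by
  intro x
  obtain ⟨n, rfl⟩ := ZMod.intCast_surjective x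
  exact ⟨(n : Od d), by simp⟩

lemma P1_max {p : ℕ} (hp : p.Prime) : (P1 d p).IsMaximal := by
  have := Fact.mk hp
  exact RingHom.ker_isMaximal_of_surjective _ (red1_surj p)

lemma P2_max {p : ℕ} (hp : p.Prime) : (P2 d p).IsMaximal := by
  have := Fact.mk hp
  exact RingHom.ker_isMaximal_of_surjective _ (red2_surj p)

lemma card_P1 (p : ℕ) : Nat.card (Od d ⧸ P1 d p) = p := by
  exact (Nat.card_congr (RingHom.quotientKerEquivOfSurjective
    (red1_surj (d := d) p)).toEquiv).trans (Nat.card_zmod p)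

lemma card_P2 (p : ℕ) : Nat.card (Od d ⧸ P2 d p) = p := by
  exact (Nat.card_congr (RingHom.quotientKerEquivOfSurjective
    (red2_surj (d := d) p)).toEquiv).trans (Nat.card_zmod p)

/-- A maximal ideal containing the prime `p` is `P1` or `P2`. -/
lemma max_class {p : ℕ} (hp : p.Prime) (M : Ideal (Od d)) (hM : M.IsMaximal)
    (hpM : (p : Od d) ∈ M) : M = P1 d p ∨ M = P2 d p := by
  have hd1 : ((d, 0) : ℤ × ℤ) ∈ Od d := mem_Od.mpr (by simp)
  have h0 : (⟨(d, 0), hd1⟩ : Od d) * wd d ∈ M := by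
    have : (⟨(d, 0), hd1⟩ : Od d) * wd d = 0 := by
      apply Subtype.ext
      simp [wd]
    rw [this]
    exact zero_mem _
  rcases hM.isPrime.mem_or_mem h0 with h | h
  · right
    refine ((P2_max hp).eq_of_le hM.ne_top ?_).symm
    intro z hz
    rw [mem_P2] at hz
    obtain ⟨x, hx⟩ := hz
    obtain ⟨k, hk⟩ := mem_Od.mp z.2
    have : z = (x : Od d) * (p : Od d) + (k : Od d) * ⟨(d, 0), hd1⟩ := by
      apply Subtype.ext
      apply Prod.ext
      · simp; linear_combination hk + hx
      · simp; linear_combination hx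
    rw [this]
    exact add_mem (Ideal.mul_mem_left _ _ hpM) (Ideal.mul_mem_left _ _ h)
  · left
    refine ((P1_max hp).eq_of_le hM.ne_top ?_).symm
    intro z hz
    rw [mem_P1] at hz
    obtain ⟨x, hx⟩ := hz
    obtain ⟨k, hk⟩ := mem_Od.mp z.2
    have : z = (x : Od d) * (p : Od d) - (k : Od d) * wd d := by
      apply Subtype.ext
      apply Prod.ext
      · simp [wd]; linear_combination hx
      · simp [wd]; linear_combination hx - hk
    rw [this]
    exact sub_mem (Ideal.mul_mem_left _ _ hpM) (Ideal.mul_mem_left _ _ h)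

lemma max_class' (M : Ideal (Od d)) (hM : M.IsMaximal) [Finite (Od d ⧸ M)] :
    ∃ p : ℕ, p.Prime ∧ Nat.card (Od d ⧸ M) = p ∧ (M = P1 d p ∨ M = P2 d p) := by
  have : IsDomain (Od d ⧸ M) := Ideal.Quotient.isDomain M
  obtain ⟨p, hp⟩ := CharP.exists (Od d ⧸ M)
  have hprime : p.Prime := CharP.char_is_prime (Od d ⧸ M) p
  have hmem : (p : Od d) ∈ M := by
    rw [← Ideal.Quotient.eq_zero_iff_mem, map_natCast]
    exact CharP.cast_eq_zero _ p
  have h := max_class hprime M hM hmem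
  refine ⟨p, hprime, ?_, h⟩
  rcases h with rfl | rfl
  · exact card_P1 p
  · exact card_P2 p

lemma finite_maxs {S : Type*} [CommRing S] [Finite S] : Finite (MaximalSpectrum S) :=
  inferInstance

lemma finite_quot (hd : 1 ≤ d) (A : Ideal (Od d))
    (hreg : ∃ z ∈ A, ((z : ℤ × ℤ)) ∈ nonZeroDivisors (ℤ × ℤ)) : Finite (Od d ⧸ A) := by
  obtain ⟨z, hzA, hz⟩ := hreg
  have hx : z.1.1 ≠ 0 := by
    intro h
    have := (mem_nonZeroDivisors_iff.mp hz).1 (1, 0) (by ext <;> simp [h])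
    simp at this
  have hy : z.1.2 ≠ 0 := by
    intro h
    have := (mem_nonZeroDivisors_iff.mp hz).1 (0, 1) (by ext <;> simp [h])
    simp at this
  set n : ℤ := z.1.1 * z.1.2 * d with hn
  have hn0 : n ≠ 0 := mul_ne_zero (mul_ne_zero hx hy) (by omega)
  have hnA : (n : Od d) ∈ A := by
    have h2 : ((z.1.2 * d, z.1.1 * d) : ℤ × ℤ) ∈ Od d :=
      mem_Od.mpr ⟨z.1.2 - z.1.1, by simp only; ring⟩
    have : (n : Od d) = ⟨_, h2⟩ * z := by
      apply Subtype.ext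
      apply Prod.ext
      · simp [hn]; ring
      · simp [hn]; ring
    rw [this]
    exact Ideal.mul_mem_left _ _ hzA
  have hfin : (Set.Ico (0 : ℤ) |n| ×ˢ Set.Ico (0 : ℤ) |n|).Finite :=
    (Set.finite_Ico _ _).prod (Set.finite_Ico _ _)
  have := hfin.to_subtype
  refine Finite.of_surjective (fun q : (Set.Ico (0 : ℤ) |n| ×ˢ Set.Ico (0 : ℤ) |n| : Set (ℤ × ℤ)) =>
    Ideal.Quotient.mk A ((q.1.1 : Od d) + (q.1.2 : Od d) * wd d)) ?_
  intro r
  obtain ⟨z, rfl⟩ := Ideal.Quotient.mk_surjective r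
  obtain ⟨k, hk⟩ := mem_Od.mp z.2
  refine ⟨⟨(z.1.1 % n, (-k) % n), ⟨⟨Int.emod_nonneg _ hn0, Int.emod_lt_abs _ hn0⟩,
    ⟨Int.emod_nonneg _ hn0, Int.emod_lt_abs _ hn0⟩⟩⟩, ?_⟩
  rw [Ideal.Quotient.eq]
  have e1 := Int.emod_add_mul_ediv z.1.1 n
  have e2 := Int.emod_add_mul_ediv (-k) n
  have : ((z.1.1 % n : ℤ) : Od d) + (((-k) % n : ℤ) : Od d) * wd d - z =
      -(((z.1.1 / n : ℤ) : Od d) + (((-k) / n : ℤ) : Od d) * wd d) * (n : Od d) := by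
    apply Subtype.ext
    apply Prod.ext
    · simp [wd]; linear_combination e1
    · simp [wd]; linear_combination e1 + d * e2 + hk
  simp only
  rw [this]
  exact Ideal.mul_mem_left _ _ hnA

lemma P1_eq_P2 {p : ℕ} (h : (p : ℤ) ∣ d) : P1 d p = P2 d p := by
  ext z
  rw [mem_P1, mem_P2]
  have := h.trans (mem_Od.mp z.2)
  exact (dvd_iff_dvd_of_dvd_sub this)

lemma P1_ne_P2 {p : ℕ} (h : ¬ (p : ℤ) ∣ d) : P1 d p ≠ P2 d p := by
  intro e
  have : wd d ∈ P1 d p := mem_P1.mpr (by simp [wd])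
  rw [e, mem_P2] at this
  exact h this

lemma span_eq {p : ℕ} (hp : p.Prime) (h : ¬ (p : ℤ) ∣ d) :
    Ideal.span {(p : Od d)} = P1 d p ⊓ P2 d p := by
  ext z
  rw [Ideal.mem_span_singleton, Ideal.mem_inf, mem_P1, mem_P2]
  constructor
  · rintro ⟨y, rfl⟩
    exact ⟨⟨y.1.1, by simp⟩, ⟨y.1.2, by simp⟩⟩
  · rintro ⟨⟨x, hx⟩, ⟨y, hy⟩⟩
    have hxy : d ∣ x - y := by
      have h1 : d ∣ (p : ℤ) * (x - y) := by
        rw [mul_sub, ← hx, ← hy]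
        exact mem_Od.mp z.2
      have hc : IsCoprime d (p : ℤ) :=
        ((Nat.prime_iff_prime_int.mp hp).coprime_iff_not_dvd.mpr h).symm
      exact hc.dvd_of_dvd_mul_left h1
    refine ⟨⟨(x, y), mem_Od.mpr hxy⟩, ?_⟩
    apply Subtype.ext
    apply Prod.ext
    · simp [hx]
    · simp [hy]

lemma card_comap (A : Ideal (Od d)) (m : Ideal (Od d ⧸ A)) :
    Nat.card (Od d ⧸ m.comap (Ideal.Quotient.mk A)) = Nat.card ((Od d ⧸ A) ⧸ m) := by
  let f := (Ideal.Quotient.mk m).comp (Ideal.Quotient.mk A)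
  have hf : Function.Surjective f :=
    Ideal.Quotient.mk_surjective.comp Ideal.Quotient.mk_surjective
  have hk : m.comap (Ideal.Quotient.mk A) = RingHom.ker f := by
    ext z
    simp [f, RingHom.mem_ker, Ideal.mem_comap, Ideal.Quotient.eq_zero_iff_mem]
  rw [hk]
  exact Nat.card_congr (RingHom.quotientKerEquivOfSurjective hf).toEquiv

open scoped Classical in
lemma card_fib (A : Ideal (Od d)) [Finite (Od d ⧸ A)] [Fintype (MaximalSpectrum (Od d ⧸ A))]
    {p : ℕ} (hp : p.Prime) :
    (Finset.univ.filter fun m : MaximalSpectrum (Od d ⧸ A) =>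
      Nat.card ((Od d ⧸ A) ⧸ m.asIdeal) = p).card =
    (({P1 d p, P2 d p} : Finset (Ideal (Od d))).filter (A ≤ ·)).card := by
  have hsurj : Function.Surjective (Ideal.Quotient.mk A) := Ideal.Quotient.mk_surjective
  refine Finset.card_bij (fun m _ => m.asIdeal.comap (Ideal.Quotient.mk A)) ?_ ?_ ?_
  · intro m hm
    simp only [Finset.mem_filter, Finset.mem_univ, true_and] at hm
    have hle : A ≤ m.asIdeal.comap (Ideal.Quotient.mk A) := by
      intro z hz
      rw [Ideal.mem_comap, Ideal.Quotient.eq_zero_iff_mem.mpr hz]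
      exact zero_mem _
    have := m.isMaximal
    have hmax : (m.asIdeal.comap (Ideal.Quotient.mk A)).IsMaximal :=
      Ideal.comap_isMaximal_of_surjective _ hsurj
    have hfin : Finite (Od d ⧸ m.asIdeal.comap (Ideal.Quotient.mk A)) := by
      apply Nat.finite_of_card_ne_zero
      rw [card_comap, hm]
      exact hp.ne_zero
    obtain ⟨q, hq, hc, h⟩ := max_class' _ hmax
    rw [card_comap, hm] at hc
    subst hc
    simp only [Finset.mem_filter, Finset.mem_insert, Finset.mem_singleton]
    exact ⟨h, hle⟩
  · intro m _ n _ h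
    exact MaximalSpectrum.ext (Ideal.comap_injective_of_surjective _ hsurj h)
  · intro I hI
    simp only [Finset.mem_filter, Finset.mem_insert, Finset.mem_singleton] at hI
    obtain ⟨hI, hA⟩ := hI
    have hmax : I.IsMaximal := by
      rcases hI with rfl | rfl
      · exact P1_max hp
      · exact P2_max hp
    have hcard : Nat.card (Od d ⧸ I) = p := by
      rcases hI with rfl | rfl
      · exact card_P1 p
      · exact card_P2 p
    have hcm : (I.map (Ideal.Quotient.mk A)).comap (Ideal.Quotient.mk A) = I := by
      rw [Ideal.comap_map_of_surjective' _ hsurj, Ideal.mk_ker, sup_eq_left]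
      exact hA
    have hmm : (I.map (Ideal.Quotient.mk A)).IsMaximal := by
      rcases Ideal.map_eq_top_or_isMaximal_of_surjective _ hsurj hmax with h | h
      · rw [h, Ideal.comap_top] at hcm
        exact absurd hcm.symm hmax.ne_top
      · exact h
    refine ⟨⟨_, hmm⟩, ?_, hcm⟩
    simp only [Finset.mem_filter, Finset.mem_univ, true_and]
    rw [← card_comap, hcm, hcard]

/-- A prime divisor of the norm lies under some maximal ideal containing `A`. -/
lemma exists_above (A : Ideal (Od d)) [Finite (Od d ⧸ A)] {p : ℕ} (hp : p.Prime)
    (h : p ∣ Nat.card (Od d ⧸ A)) : A ≤ P1 d p ∨ A ≤ P2 d p := by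
  have hne : A ⊔ Ideal.span {(p : Od d)} ≠ ⊤ := by
    intro htop
    have h1 : (1 : Od d) ∈ A ⊔ Ideal.span {(p : Od d)} := by rw [htop]; trivial
    obtain ⟨a, ha, b, hb, hab⟩ := Submodule.mem_sup.mp h1
    obtain ⟨c, rfl⟩ := Ideal.mem_span_singleton.mp hb
    have := Fact.mk hp
    obtain ⟨x, hx⟩ := exists_prime_addOrderOf_dvd_card' p h
    have hpx : (p : Od d ⧸ A) * x = 0 := by
      rw [← nsmul_eq_mul, ← hx]
      exact addOrderOf_nsmul_eq_zero x
    have hone : (p : Od d ⧸ A) * Ideal.Quotient.mk A c = 1 := by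
      have := congrArg (Ideal.Quotient.mk A) hab
      rw [map_add, Ideal.Quotient.eq_zero_iff_mem.mpr ha, zero_add, map_mul, map_natCast,
        map_one] at this
      exact this
    have hx0 : x = 0 := by
      linear_combination (Ideal.Quotient.mk A c) * hpx - x * hone
    rw [hx0, addOrderOf_zero] at hx
    exact hp.one_lt.ne hx
  obtain ⟨M, hM, hle⟩ := Ideal.exists_le_maximal _ hne
  have hA : A ≤ M := le_sup_left.trans hle
  rcases max_class hp M hM (hle (Ideal.mem_sup_right (Ideal.mem_span_singleton_self _))) with h | h
  · exact Or.inl (h ▸ hA)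
  · exact Or.inr (h ▸ hA)

open scoped Classical in
lemma card_cp (A : Ideal (Od d)) [Finite (Od d ⧸ A)] {p : ℕ} (hp : p.Prime)
    (h : p ∣ Nat.card (Od d ⧸ A)) :
    (({P1 d p, P2 d p} : Finset (Ideal (Od d))).filter (A ≤ ·)).card =
      if ¬ ((p : ℤ) ∣ d ^ 2) ∧ A ≤ Ideal.span {(p : Od d)} then 2 else 1 := by
  have hab := exists_above A hp h
  simp only [(Nat.prime_iff_prime_int.mp hp).dvd_pow_iff_dvd two_ne_zero]
  by_cases hpd : (p : ℤ) ∣ d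
  · rw [← P1_eq_P2 hpd, or_self] at hab
    rw [← P1_eq_P2 hpd]
    simp [hpd, hab, Finset.filter_singleton]
  · simp only [span_eq hp hpd, le_inf_iff]
    have hne := P1_ne_P2 hpd
    rw [Finset.filter_insert, Finset.filter_singleton]
    by_cases h1 : A ≤ P1 d p <;> by_cases h2 : A ≤ P2 d p <;> simp_all

end order

end GF

open scoped Classical in
/-- Theorem 2.8 (ii): for a regular ideal `𝔞` of `𝒪_D`, the index of the
principal congruence subgroup `Γ^D(𝔞)` in `SL₂(𝒪_D)` equals
`N(𝔞)³ · ∏_{p ∣ N(𝔞)} (1 − 1/p²)^{c_p(𝔞)}`, where the product runs over the prime numbers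
`p` dividing `N(𝔞)` and `c_p(𝔞) = 2` if `p ∤ D = d²` and `𝔞 ⊆ (p)`, and `c_p(𝔞) = 1`
otherwise. -/
theorem index_gamma_full (d : ℤ) (hd : 1 ≤ d) (A : Ideal (Od d))
    (hreg : ∃ z ∈ A, ((z : ℤ × ℤ)) ∈ nonZeroDivisors (ℤ × ℤ)) :
    ((GammaFull (Od d) A).index : ℚ) =
      (Nat.card (Od d ⧸ A) : ℚ) ^ 3 *
        ∏ᶠ p ∈ {p : ℕ | p.Prime ∧ p ∣ Nat.card (Od d ⧸ A)},
          (1 - 1 / (p : ℚ) ^ 2) ^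
            (if ¬ ((p : ℤ) ∣ d ^ 2) ∧ A ≤ Ideal.span {(p : Od d)} then 2 else 1) := by
  have hfin := GF.finite_quot hd A hreg
  have hmf : Finite (MaximalSpectrum (Od d ⧸ A)) := GF.finite_maxs
  have : Fintype (MaximalSpectrum (Od d ⧸ A)) := Fintype.ofFinite _
  rw [GF.index_gamma]
  congr 1
  have hN : Nat.card (Od d ⧸ A) ≠ 0 := Nat.card_pos.ne'
  have hset : {p : ℕ | p.Prime ∧ p ∣ Nat.card (Od d ⧸ A)} =
      ((Nat.card (Od d ⧸ A)).primeFactors : Set ℕ) := by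
    ext p
    simp [Nat.mem_primeFactors, hN]
  rw [hset, finprod_mem_coe_finset]
  have hmaps : ∀ m ∈ (Finset.univ : Finset (MaximalSpectrum (Od d ⧸ A))),
      Nat.card ((Od d ⧸ A) ⧸ m.asIdeal) ∈ (Nat.card (Od d ⧸ A)).primeFactors := by
    intro m _
    have := m.isMaximal
    have hmax : (m.asIdeal.comap (Ideal.Quotient.mk A)).IsMaximal :=
      Ideal.comap_isMaximal_of_surjective _ Ideal.Quotient.mk_surjective
    have hf : Finite ((Od d ⧸ A) ⧸ m.asIdeal) :=
      Finite.of_surjective _ (Ideal.Quotient.mk_surjective (I := m.asIdeal))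
    have hfin : Finite (Od d ⧸ m.asIdeal.comap (Ideal.Quotient.mk A)) := by
      apply Nat.finite_of_card_ne_zero
      rw [GF.card_comap]
      exact Nat.card_pos.ne'
    obtain ⟨q, hq, hc, -⟩ := GF.max_class' _ hmax
    rw [GF.card_comap] at hc
    rw [Nat.mem_primeFactors]
    refine ⟨hc ▸ hq, ?_, hN⟩
    exact AddSubgroup.card_quotient_dvd_card m.asIdeal.toAddSubgroup
  rw [← Finset.prod_fiberwise_of_maps_to' hmaps (fun q : ℕ => 1 - 1 / (q : ℚ) ^ 2)]
  refine Finset.prod_congr rfl fun p hp => ?_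
  rw [Nat.mem_primeFactors] at hp
  rw [Finset.prod_const, GF.card_fib A hp.1, GF.card_cp A hp.1 hp.2.1]
end
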